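/- For every integer n ≥ 0, DSOME(15625n + 651) ≡ 5·DSOME(25n + 1) + DSOME(625n + 26) − 5·DSOME(n) (mod 8). -/

import Mathlib

open PowerSeries

/-- `DSOME n`: the sum, over all partitions of `n` into distinct parts, of
(the sum of the odd parts) minus (the sum of the even parts). `DSOME 0 = 0`. -/
def DSOME (n : ℕ) : ℤ :=
  ∑ p ∈ Nat.Partition.distincts n,
    (((p.parts.filter (fun i => Odd i)).sum : ℤ) - ((p.parts.filter (fun i => Even i)).sum : ℤ))

/-- The derivation `X * d/dX` on power series. -/
noncomputable def eulerDerivation (R : Type*) [CommRing R] : Derivation R R⟦X⟧ R⟦X⟧ :=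
  (X : R⟦X⟧) • derivative R

theorem coeff_eulerDerivation {R : Type*} [CommRing R] (f : R⟦X⟧) (n : ℕ) :
    coeff n (eulerDerivation R f) = n * coeff n f := by
  rw [eulerDerivation, Derivation.smul_apply, smul_eq_mul]
  cases n with
  | zero => simp
  | succ n =>
    rw [coeff_succ_X_mul, coeff_derivative]
    push_cast
    ring

theorem eulerDerivation_expand {R : Type*} [CommRing R] (f : R⟦X⟧) :
    eulerDerivation R (expand 2 two_ne_zero f) =
      2 * expand 2 two_ne_zero (eulerDerivation R f) := by
  ext n
  rw [coeff_eulerDerivation, two_mul, map_add, coeff_expand, coeff_expand, coeff_eulerDerivation]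
  split_ifs with h
  · obtain ⟨m, rfl⟩ := h
    rw [Nat.mul_div_cancel_left m two_pos]
    push_cast
    ring
  · simp

theorem map_eulerDerivation {R S : Type*} [CommRing R] [CommRing S] (g : R →+* S) (f : R⟦X⟧) :
    map g (eulerDerivation R f) = eulerDerivation S (map g f) := by
  ext n
  simp [coeff_eulerDerivation]

theorem expand_two_eq_sq (f : (ZMod 2)⟦X⟧) : expand 2 two_ne_zero f = f ^ 2 := by
  have h := MvPowerSeries.map_frobenius_expand (R := ZMod 2) 2 two_ne_zero (f := f)
  rw [ZMod.frobenius_zmod, MvPowerSeries.map_id] at h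
  exact h

theorem exists_eq_two_mul {f : ℤ⟦X⟧} (h : map (Int.castRingHom (ZMod 2)) f = 0) :
    ∃ g, f = 2 * g := by
  have h' : ∀ n, (2 : ℤ) ∣ coeff n f := fun n => by
    have := congrArg (coeff n) h
    rw [coeff_map, map_zero, eq_intCast] at this
    exact (ZMod.intCast_zmod_eq_zero_iff_dvd _ 2).1 this
  choose g hg using h'
  refine ⟨mk g, ?_⟩
  ext n
  rw [two_mul, map_add, coeff_mk, hg n, two_mul]

/-- The series `∑ (-1) ^ k * X ^ (k ^ 2)` over the positive integers `k`. -/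
noncomputable def squareSeries : ℤ⟦X⟧ :=
  mk fun n => if 0 < n ∧ IsSquare n then (-1) ^ n else 0

theorem eulerDerivation_squareSeries :
    eulerDerivation (ZMod 2) (map (Int.castRingHom (ZMod 2)) squareSeries) =
      map (Int.castRingHom (ZMod 2)) squareSeries -
        map (Int.castRingHom (ZMod 2)) squareSeries ^ 4 := by
  rw [show 4 = 2 * 2 from rfl, pow_mul, ← expand_two_eq_sq, ← expand_two_eq_sq]
  have hs : ∀ n, coeff n (map (Int.castRingHom (ZMod 2)) squareSeries) =
      if 0 < n ∧ IsSquare n then 1 else 0 := fun n => by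
    rw [coeff_map, squareSeries, coeff_mk]
    split_ifs
    · simp [show (-1 : ZMod 2) = 1 from rfl]
    · simp
  ext n
  rw [coeff_eulerDerivation, map_sub, coeff_expand]
  by_cases h2 : 2 ∣ n
  · obtain ⟨m, rfl⟩ := h2
    rw [if_pos (dvd_mul_right 2 m), Nat.mul_div_cancel_left m two_pos, coeff_expand, hs]
    have h0 : ((2 * m : ℕ) : ZMod 2) = 0 := by
      rw [ZMod.natCast_eq_zero_iff]
      exact dvd_mul_right 2 m
    rw [h0, zero_mul]
    by_cases hm : 2 ∣ m
    · obtain ⟨l, rfl⟩ := hm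
      rw [if_pos (dvd_mul_right 2 l), Nat.mul_div_cancel_left l two_pos, hs]
      have : (0 < 2 * (2 * l) ∧ IsSquare (2 * (2 * l))) ↔ (0 < l ∧ IsSquare l) := by
        refine and_congr (by omega) ⟨?_, ?_⟩
        · rintro ⟨r, hr⟩
          obtain ⟨t, rfl⟩ : 2 ∣ r := by
            have : 2 ∣ r * r := ⟨2 * l, hr.symm⟩
            rcases Nat.prime_two.dvd_mul.1 this with h | h <;> exact h
          exact ⟨t, by linarith⟩
        · rintro ⟨r, rfl⟩
          exact ⟨2 * r, by ring⟩
      simp only [this, sub_self]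
    · rw [if_neg hm, if_neg, sub_zero]
      rintro ⟨-, r, hr⟩
      obtain ⟨t, rfl⟩ : 2 ∣ r := by
        have : 2 ∣ r * r := ⟨m, hr.symm⟩
        rcases Nat.prime_two.dvd_mul.1 this with h | h <;> exact h
      exact hm ⟨t * t, by linarith⟩
  · rw [if_neg h2, sub_zero]
    have h1 : (n : ZMod 2) = 1 := by
      rw [← Nat.cast_one, ZMod.natCast_eq_natCast_iff]
      unfold Nat.ModEq
      omega
    rw [h1, one_mul]

theorem logDeriv_eq_of_two (F : ℤ⟦X⟧) (hF : constantCoeff F = 1)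
    (h : expand 2 two_ne_zero (F * (1 + 2 * squareSeries)) = F * (F * (1 + 2 * squareSeries))) :
    map (Int.castRingHom (ZMod 2)) (eulerDerivation ℤ F) =
      map (Int.castRingHom (ZMod 2)) (F * (squareSeries + squareSeries ^ 2)) := by
  have h1 := congrArg (eulerDerivation ℤ) h
  rw [eulerDerivation_expand] at h1
  simp only [Derivation.leibniz, smul_eq_mul, map_add, map_mul, Derivation.map_one_eq_zero,
    show (2 : ℤ⟦X⟧) = ((2 : ℕ) : ℤ⟦X⟧) by norm_num, Derivation.map_natCast, map_natCast,
    map_one, map_zero] at h1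
  push_cast at h1
  have h2 : (2 : ℤ⟦X⟧) ≠ 0 := fun h0 => by
    have := congrArg (constantCoeff (R := ℤ)) h0
    rw [map_ofNat, map_zero] at this
    exact two_ne_zero this
  obtain ⟨D, hD⟩ : ∃ D, expand 2 two_ne_zero (eulerDerivation ℤ F) =
      F * eulerDerivation ℤ F + F ^ 2 * eulerDerivation ℤ squareSeries + 2 * D := by
    refine ⟨F * eulerDerivation ℤ F * squareSeries
      - expand 2 two_ne_zero F * expand 2 two_ne_zero (eulerDerivation ℤ squareSeries)
      - expand 2 two_ne_zero (eulerDerivation ℤ F) * expand 2 two_ne_zero squareSeries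
      , mul_left_cancel₀ h2 ?_⟩
    linear_combination h1
  have h3 := congrArg (map (Int.castRingHom (ZMod 2))) hD
  simp only [map_add, map_mul, map_pow, map_eulerDerivation, map_expand, map_ofNat,
    eulerDerivation_squareSeries, expand_two_eq_sq] at h3 ⊢
  set f := map (Int.castRingHom (ZMod 2)) F
  set s := map (Int.castRingHom (ZMod 2)) squareSeries
  have hc : (2 : (ZMod 2)⟦X⟧) = 0 := by
    rw [show (2 : (ZMod 2)⟦X⟧) = C (2 : ZMod 2) from (map_ofNat C 2).symm,
      show (2 : ZMod 2) = 0 from rfl, map_zero]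
  set g := eulerDerivation (ZMod 2) f
  have hf : constantCoeff f = 1 := by
    rw [← coeff_zero_eq_constantCoeff_apply, coeff_map, coeff_zero_eq_constantCoeff_apply, hF,
      map_one]
  have hs : constantCoeff s = 0 := by
    rw [← coeff_zero_eq_constantCoeff_apply, coeff_map, squareSeries, coeff_mk]
    simp
  have hg : constantCoeff g = 0 := by
    rw [← coeff_zero_eq_constantCoeff_apply, coeff_eulerDerivation, Nat.cast_zero, zero_mul]
  have h4 : (g - f * (s + s ^ 2)) * (g - f * (s + s ^ 2) - f) = 0 := by
    linear_combination h3 + hc * (map (Int.castRingHom (ZMod 2)) D -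
      g * f * (s + s ^ 2) + f ^ 2 * (s + s ^ 2 + s ^ 3))
  rcases mul_eq_zero.1 h4 with h5 | h5
  · exact sub_eq_zero.1 h5
  · have := congrArg constantCoeff h5
    simp [hf, hs, hg] at this

theorem exists_derivation_sub_eq_add_eight_mul (F O : ℤ⟦X⟧)
    (hF : constantCoeff F = 1) (hO : F = O * expand 2 two_ne_zero F)
    (h : expand 2 two_ne_zero (F * (1 + 2 * squareSeries)) = F * (F * (1 + 2 * squareSeries))) :
    ∃ D, expand 2 two_ne_zero F * eulerDerivation ℤ O -
        O * eulerDerivation ℤ (expand 2 two_ne_zero F) =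
      (1 + 2 * squareSeries) * eulerDerivation ℤ (F * (1 + 2 * squareSeries)) -
        F * (1 + 2 * squareSeries) * eulerDerivation ℤ (1 + 2 * squareSeries) + 8 * D := by
  obtain ⟨D, hD⟩ : ∃ D, (squareSeries + squareSeries ^ 2) * eulerDerivation ℤ F +
      O * expand 2 two_ne_zero (eulerDerivation ℤ F) = 2 * D := by
    refine exists_eq_two_mul ?_
    have h1 := logDeriv_eq_of_two F hF h
    have h2 := congrArg (map (Int.castRingHom (ZMod 2))) hO
    simp only [map_add, map_mul, map_pow, map_expand, expand_two_eq_sq] at h1 h2 ⊢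
    rw [h1]
    set f := map (Int.castRingHom (ZMod 2)) F
    set s := map (Int.castRingHom (ZMod 2)) squareSeries
    have hc : (2 : (ZMod 2)⟦X⟧) = 0 := by
      rw [show (2 : (ZMod 2)⟦X⟧) = C (2 : ZMod 2) from (map_ofNat C 2).symm,
        show (2 : ZMod 2) = 0 from rfl, map_zero]
    linear_combination hc * f * (s + s ^ 2) ^ 2 - h2 * (s + s ^ 2) ^ 2
  refine ⟨-D, ?_⟩
  have h3 : eulerDerivation ℤ F = O * eulerDerivation ℤ (expand 2 two_ne_zero F) +
      expand 2 two_ne_zero F * eulerDerivation ℤ O := by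
    conv_lhs => rw [hO]
    rw [Derivation.leibniz, smul_eq_mul, smul_eq_mul]
  have h4 := eulerDerivation_expand F
  rw [Derivation.leibniz (eulerDerivation ℤ) F, smul_eq_mul, smul_eq_mul]
  linear_combination (-1) * h3 - 2 * O * h4 - 4 * hD

theorem eq_of_forall_X_pow_dvd_sub {f g : ℤ⟦X⟧} (h : ∀ N, X ^ N ∣ f - g) : f = g := by
  ext n
  have := X_pow_dvd_iff.1 (h (n + 1)) n n.lt_succ_self
  rwa [map_sub, sub_eq_zero] at this

theorem exists_X_pow_dvd_sub (P : ℕ → ℤ⟦X⟧) (h : ∀ N, X ^ N ∣ P (N + 1) - P N) :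
    ∃ f, ∀ N, X ^ N ∣ f - P N := by
  have h' : ∀ N k, X ^ N ∣ P (N + k) - P N := fun N k => by
    induction k with
    | zero => simp
    | succ k ih =>
      have := dvd_add ((pow_dvd_pow X (Nat.le_add_right N k)).trans (h (N + k))) ih
      rwa [sub_add_sub_cancel] at this
  refine ⟨mk fun n => coeff n (P (n + 1)), fun N => X_pow_dvd_iff.2 fun m hm => ?_⟩
  obtain ⟨k, rfl⟩ := Nat.exists_eq_add_of_le (Nat.succ_le_of_lt hm)
  have := X_pow_dvd_iff.1 (h' (m + 1) k) m m.lt_succ_self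
  rw [map_sub, sub_eq_zero] at this
  rw [map_sub, coeff_mk, Nat.succ_eq_add_one, this, sub_self]

theorem X_pow_dvd_eulerDerivation {N : ℕ} {f : ℤ⟦X⟧} (h : X ^ N ∣ f) :
    X ^ N ∣ eulerDerivation ℤ f :=
  X_pow_dvd_iff.2 fun m hm => by
    rw [coeff_eulerDerivation, X_pow_dvd_iff.1 h m hm, mul_zero]

theorem X_pow_dvd_expand {N : ℕ} {f : ℤ⟦X⟧} (h : X ^ N ∣ f) :
    X ^ N ∣ expand 2 two_ne_zero f := by
  obtain ⟨g, rfl⟩ := h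
  rw [map_mul, map_pow, expand_X, ← pow_mul, mul_comm 2 N, pow_mul, sq, mul_assoc]
  exact dvd_mul_right _ _

/-- The quotient `(1 - X ^ i) / (1 + X ^ i)` for positive `i`. -/
noncomputable def subDivAdd (i : ℕ) : ℤ⟦X⟧ := (1 - X ^ i) * invOfUnit (1 + X ^ i) 1

theorem subDivAdd_mul {i : ℕ} (hi : i ≠ 0) : subDivAdd i * (1 + X ^ i) = 1 - X ^ i := by
  rw [subDivAdd, mul_assoc, mul_comm (invOfUnit _ _), mul_invOfUnit, mul_one]
  simp [hi]

/-- The product `∏ (1 - X ^ i) / (1 + X ^ i)` over `k < i ≤ k + n`. -/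
noncomputable def prodSubDivAdd (k n : ℕ) : ℤ⟦X⟧ :=
  ∏ i ∈ Finset.range n, subDivAdd (k + i + 1)

theorem prodSubDivAdd_succ_mul (k n : ℕ) :
    prodSubDivAdd k (n + 1) * (1 + X ^ (k + n + 1)) =
      prodSubDivAdd k n * (1 - X ^ (k + n + 1)) := by
  rw [prodSubDivAdd, Finset.prod_range_succ, mul_assoc, subDivAdd_mul (Nat.succ_ne_zero _)]
  rfl

theorem one_sub_mul_prodSubDivAdd (k n : ℕ) :
    (1 - X ^ (k + 1)) * prodSubDivAdd (k + 1) n =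
      (1 + X ^ (k + 1)) * prodSubDivAdd k (n + 1) := by
  rw [prodSubDivAdd, prodSubDivAdd, Finset.prod_range_succ',
    ← subDivAdd_mul (Nat.succ_ne_zero k)]
  simp only [add_zero, Nat.succ_eq_add_one,
    show ∀ i, k + (i + 1) + 1 = k + 1 + i + 1 by intro i; ring]
  ring

/-- Partial sums of the series whose value at `k` is a tail of `∑ (-1) ^ j * X ^ (j ^ 2)`. -/
noncomputable def squareTail (k N : ℕ) : ℤ⟦X⟧ :=
  (1 + X ^ (k + 1)) * ∑ n ∈ Finset.range N, prodSubDivAdd k n * X ^ ((k + 1) * n)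

theorem telescope_prodSubDivAdd (k N : ℕ) :
    (1 - X ^ k) * ∑ n ∈ Finset.range N, prodSubDivAdd k n * X ^ (k * n) + X ^ k * squareTail k N =
      1 + X ^ k - prodSubDivAdd k N * X ^ (k * N) * (1 + X ^ (k + N)) := by
  rw [squareTail]
  induction N with
  | zero => simp [prodSubDivAdd]
  | succ N ih =>
    rw [Finset.sum_range_succ, Finset.sum_range_succ]
    have h := prodSubDivAdd_succ_mul k N
    linear_combination ih + X ^ (k * (N + 1)) * h

theorem squareTail_recurrence (k N : ℕ) :
    X ^ N ∣ squareTail k N - ((1 + X ^ (k + 1)) ^ 2 - X ^ (2 * (k + 1)) * squareTail (k + 1) N) := by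
  have h := telescope_prodSubDivAdd (k + 1) N
  rw [Finset.mul_sum] at h
  simp only [← mul_assoc, one_sub_mul_prodSubDivAdd] at h
  have h1 : squareTail k (N + 1) = (1 + X ^ (k + 1)) + X ^ (k + 1) *
      ∑ n ∈ Finset.range N,
        (1 + X ^ (k + 1)) * prodSubDivAdd k (n + 1) * X ^ ((k + 1) * n) := by
    rw [squareTail, Finset.sum_range_succ', mul_add, Finset.mul_sum, Finset.mul_sum, add_comm]
    congr 1
    · simp [prodSubDivAdd]
    · refine Finset.sum_congr rfl fun n _ => ?_
      ring
  have h2 : squareTail k (N + 1) = squareTail k N +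
      (1 + X ^ (k + 1)) * (prodSubDivAdd k N * X ^ ((k + 1) * N)) := by
    rw [squareTail, squareTail, Finset.sum_range_succ, mul_add]
  refine ⟨-(1 + X ^ (k + 1)) * (prodSubDivAdd k N * X ^ (k * N)) -
    X ^ (k + 1) * (prodSubDivAdd (k + 1) N * X ^ (k * N) * (1 + X ^ (k + 1 + N))), ?_⟩
  linear_combination h1 - h2 + X ^ (k + 1) * h

theorem prodSubDivAdd_sub_sum (N K : ℕ) :
    X ^ N ∣ prodSubDivAdd 0 N - (1 + 2 * ∑ j ∈ Finset.range K, (-1) ^ (j + 1) * X ^ ((j + 1) ^ 2) +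
      (-1) ^ K * X ^ (K * (K + 1)) * (1 - squareTail K N)) := by
  induction K with
  | zero =>
    have h := telescope_prodSubDivAdd 0 N
    simp only [pow_zero, sub_self, zero_mul, zero_add, one_mul, mul_one] at h
    refine ⟨-prodSubDivAdd 0 N, ?_⟩
    simp only [Finset.range_zero, Finset.sum_empty, pow_zero, zero_mul]
    linear_combination h
  | succ K ih =>
    obtain ⟨d, hd⟩ := ih
    obtain ⟨e, he⟩ := squareTail_recurrence K N
    refine ⟨d - (-1) ^ K * X ^ (K * (K + 1)) * e, ?_⟩
    rw [Finset.sum_range_succ]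
    linear_combination hd - (-1) ^ K * X ^ (K * (K + 1)) * he

theorem X_pow_dvd_squareSeries_sub (N : ℕ) :
    X ^ N ∣ squareSeries - ∑ j ∈ Finset.range N, (-1) ^ (j + 1) * X ^ ((j + 1) ^ 2) := by
  refine X_pow_dvd_iff.2 fun m hm => ?_
  have hc : ∀ j, coeff m ((-1 : ℤ⟦X⟧) ^ (j + 1) * X ^ ((j + 1) ^ 2)) =
      if m = (j + 1) ^ 2 then (-1) ^ (j + 1) else 0 := fun j => by
    rw [show (-1 : ℤ⟦X⟧) ^ (j + 1) = C ((-1) ^ (j + 1)) by simp, coeff_C_mul, coeff_X_pow]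
    simp
  rw [map_sub, map_sum, squareSeries, coeff_mk, sub_eq_zero]
  simp only [hc]
  split_ifs with h
  · obtain ⟨h0, r, rfl⟩ := h
    obtain ⟨j, rfl⟩ := Nat.exists_eq_succ_of_ne_zero (n := r) (by rintro rfl; simp at h0)
    rw [Finset.sum_eq_single j]
    · rw [if_pos (sq _).symm, pow_mul]
      rcases neg_one_pow_eq_or ℤ (j + 1) with h | h <;> simp [h]
    · intro b _ hb
      rw [if_neg]
      intro h
      rw [← sq] at h
      have := Nat.pow_left_injective two_ne_zero h
      simp at this
      omega
    · intro hj
      simp only [Finset.mem_range] at hj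
      exact absurd hm (by nlinarith)
  · refine (Finset.sum_eq_zero fun j _ => if_neg fun hj => h ⟨?_, j + 1, ?_⟩).symm
    · rw [hj]
      positivity
    · rw [hj, sq]

theorem X_pow_dvd_pentagonalSeries_sub (N : ℕ) :
    X ^ N ∣ pentagonalSeries ℤ - ∏ i ∈ Finset.range N, (1 - X ^ (i + 1)) := by
  obtain ⟨f, hf⟩ := exists_X_pow_dvd_sub (fun N => ∏ i ∈ Finset.range N, (1 - X ^ (i + 1)))
    fun N => ⟨-X * ∏ i ∈ Finset.range N, (1 - X ^ (i + 1)), by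
      rw [Finset.prod_range_succ]
      ring⟩
  suffices pentagonalSeries ℤ = f from this ▸ hf N
  ext n
  obtain ⟨s, hs⟩ := Filter.eventually_atTop.1 (coeff_prod_one_sub_X_pow_eventually_eq ℤ n)
  obtain ⟨M, hM⟩ := s.exists_nat_subset_range
  have h1 := hs (Finset.range (M + (n + 1)))
    (hM.trans (Finset.range_subset_range.2 (Nat.le_add_right _ _)))
  have h2 := X_pow_dvd_iff.1 (hf (M + (n + 1))) n (by omega)
  rw [map_sub, sub_eq_zero] at h2
  rw [h2, h1]

theorem prodSubDivAdd_mul_prod (N : ℕ) :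
    prodSubDivAdd 0 N * ∏ i ∈ Finset.range N, (1 + X ^ (i + 1)) =
      ∏ i ∈ Finset.range N, (1 - X ^ (i + 1)) := by
  rw [prodSubDivAdd, ← Finset.prod_mul_distrib]
  refine Finset.prod_congr rfl fun i _ => ?_
  rw [zero_add, subDivAdd_mul (Nat.succ_ne_zero i)]

/-- Gauss's identity `∏ (1 - X ^ i) / (1 + X ^ i) = ∑ (-1) ^ k * X ^ (k ^ 2)`. -/
theorem mul_squareSeries_eq_pentagonalSeries {F : ℤ⟦X⟧}
    (hF : ∀ N, X ^ N ∣ F - ∏ i ∈ Finset.range N, (1 + X ^ (i + 1))) :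
    F * (1 + 2 * squareSeries) = pentagonalSeries ℤ := by
  refine eq_of_forall_X_pow_dvd_sub fun N => ?_
  obtain ⟨a, ha⟩ := hF N
  obtain ⟨b, hb⟩ := prodSubDivAdd_sub_sum N N
  obtain ⟨c, hc⟩ := X_pow_dvd_squareSeries_sub N
  obtain ⟨d, hd⟩ := X_pow_dvd_pentagonalSeries_sub N
  have h := prodSubDivAdd_mul_prod N
  rw [mul_add, mul_one, pow_add] at hb
  refine ⟨a * (1 + 2 * squareSeries) + (∏ i ∈ Finset.range N, (1 + X ^ (i + 1))) *
    (2 * c - b - (-1) ^ N * X ^ (N * N) * (1 - squareTail N N)) - d, ?_⟩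
  linear_combination (1 + 2 * squareSeries) * ha + (∏ i ∈ Finset.range N, (1 + X ^ (i + 1))) *
    (2 * hc - hb) - hd + h

theorem expand_pentagonalSeries {F : ℤ⟦X⟧}
    (hF : ∀ N, X ^ N ∣ F - ∏ i ∈ Finset.range N, (1 + X ^ (i + 1))) :
    expand 2 two_ne_zero (pentagonalSeries ℤ) = F * pentagonalSeries ℤ := by
  refine eq_of_forall_X_pow_dvd_sub fun N => ?_
  obtain ⟨a, ha⟩ := hF N
  obtain ⟨d, hd⟩ := X_pow_dvd_pentagonalSeries_sub N
  obtain ⟨e, he⟩ := X_pow_dvd_expand (X_pow_dvd_pentagonalSeries_sub N)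
  have h : expand 2 two_ne_zero (∏ i ∈ Finset.range N, (1 - X ^ (i + 1)) : ℤ⟦X⟧) =
      (∏ i ∈ Finset.range N, (1 + X ^ (i + 1))) * ∏ i ∈ Finset.range N, (1 - X ^ (i + 1)) := by
    rw [map_prod, ← Finset.prod_mul_distrib]
    refine Finset.prod_congr rfl fun i _ => ?_
    rw [map_sub, map_one, map_pow, expand_X]
    ring
  rw [map_sub] at he
  refine ⟨e - a * pentagonalSeries ℤ - (∏ i ∈ Finset.range N, (1 + X ^ (i + 1))) * d, ?_⟩
  linear_combination he + h - pentagonalSeries ℤ * ha -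
    (∏ i ∈ Finset.range N, (1 + X ^ (i + 1))) * hd

theorem prod_range_two_mul (N : ℕ) :
    ∏ i ∈ Finset.range (2 * N), (1 + X ^ (i + 1) : ℤ⟦X⟧) =
      (∏ i ∈ Finset.range N, (1 + X ^ (2 * i + 1))) *
        expand 2 two_ne_zero (∏ i ∈ Finset.range N, (1 + X ^ (i + 1))) := by
  induction N with
  | zero => simp
  | succ N ih =>
    rw [show 2 * (N + 1) = 2 * N + 1 + 1 by ring, Finset.prod_range_succ, Finset.prod_range_succ,
      ih, Finset.prod_range_succ, Finset.prod_range_succ, map_mul, map_add, map_one, map_pow,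
      expand_X]
    ring

theorem eq_mul_expand {F O : ℤ⟦X⟧}
    (hF : ∀ N, X ^ N ∣ F - ∏ i ∈ Finset.range N, (1 + X ^ (i + 1)))
    (hO : ∀ N, X ^ N ∣ O - ∏ i ∈ Finset.range N, (1 + X ^ (2 * i + 1))) :
    F = O * expand 2 two_ne_zero F := by
  refine eq_of_forall_X_pow_dvd_sub fun N => ?_
  obtain ⟨a, ha⟩ := (pow_dvd_pow X (by omega : N ≤ 2 * N)).trans (hF (2 * N))
  obtain ⟨b, hb⟩ := hO N
  obtain ⟨c, hc⟩ := X_pow_dvd_expand (hF N)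
  have h := prod_range_two_mul N
  rw [map_sub] at hc
  refine ⟨a - b * expand 2 two_ne_zero F -
    (∏ i ∈ Finset.range N, (1 + X ^ (2 * i + 1))) * c, ?_⟩
  linear_combination ha + h - expand 2 two_ne_zero F * hb -
    (∏ i ∈ Finset.range N, (1 + X ^ (2 * i + 1))) * hc

theorem eulerDerivation_X_pow {R : Type*} [CommRing R] (n : ℕ) :
    eulerDerivation R (X ^ n) = C (n : R) * X ^ n := by
  ext m
  rw [coeff_eulerDerivation, coeff_C_mul, coeff_X_pow]
  split_ifs with h
  · rw [h]
  · simp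

theorem DSOME_eq_sum_powerset {n M : ℕ} (h : n < M) :
    DSOME n = ∑ t ∈ (Finset.Ico 1 M).powerset with ∑ i ∈ t, i = n,
      ∑ i ∈ t, if Odd i then (i : ℤ) else -i := by
  refine Finset.sum_bij' (fun p _ => p.parts.toFinset)
    (fun t ht => ⟨t.val, fun {i} hi => ?_, ?_⟩) ?_ ?_ ?_ ?_ ?_
  · have := Finset.mem_powerset.1 (Finset.mem_filter.1 ht).1 hi
    exact (Finset.mem_Ico.1 this).1
  · rw [← (Finset.mem_filter.1 ht).2]
    exact congrArg Multiset.sum (Multiset.map_id _).symm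
  · intro p hp
    have hd : p.parts.Nodup := (Finset.mem_filter.1 hp).2
    rw [Finset.mem_filter, Finset.mem_powerset]
    refine ⟨fun i hi => ?_, ?_⟩
    · have hi := Multiset.mem_toFinset.1 hi
      have h1 := p.parts_pos hi
      have h2 := p.le_of_mem_parts hi
      exact Finset.mem_Ico.2 ⟨h1, by omega⟩
    · refine Eq.trans ?_ p.parts_sum
      rw [Finset.sum, Multiset.toFinset_val, hd.dedup, Multiset.map_id']
  · intro t ht
    exact Finset.mem_filter.2 ⟨Finset.mem_univ _, t.nodup⟩
  · intro p hp
    have hd : p.parts.Nodup := (Finset.mem_filter.1 hp).2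
    exact Nat.Partition.ext (Multiset.dedup_eq_self.2 hd)
  · intro t ht
    exact Finset.val_toFinset t
  · intro p hp
    have hd : p.parts.Nodup := (Finset.mem_filter.1 hp).2
    generalize p.parts = m at hd
    lift m to Finset ℕ using hd
    rw [Finset.val_toFinset, Finset.sum_ite, Finset.sum_neg_distrib, ← sub_eq_add_neg]
    simp only [Nat.not_odd_iff_even, ← Finset.filter_val, Finset.sum_val, Nat.cast_sum, id]

theorem sum_powerset_C_mul_X_pow (s : Finset ℕ) :
    ∑ t ∈ s.powerset, C (∑ i ∈ t, if Odd i then (i : ℤ) else -i) * X ^ (∑ i ∈ t, i) =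
      (∏ i ∈ s, if Odd i then 1 else 1 + X ^ i) *
          eulerDerivation ℤ (∏ i ∈ s, if Odd i then 1 + X ^ i else 1) -
        (∏ i ∈ s, if Odd i then 1 + X ^ i else 1) *
          eulerDerivation ℤ (∏ i ∈ s, if Odd i then 1 else 1 + X ^ i) := by
  induction s using Finset.induction with
  | empty => simp
  | insert a s ha ih =>
    have hF : ∑ t ∈ s.powerset, (X : ℤ⟦X⟧) ^ (∑ i ∈ t, i) =
        (∏ i ∈ s, if Odd i then 1 + X ^ i else 1) * ∏ i ∈ s, if Odd i then 1 else 1 + X ^ i := by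
      rw [← Finset.prod_mul_distrib]
      rw [Finset.prod_congr rfl fun i _ => show (_ : ℤ⟦X⟧) = 1 + X ^ i by split_ifs <;> ring,
        Finset.prod_one_add]
      exact Finset.sum_congr rfl fun t _ => (Finset.prod_pow_eq_pow_sum t _ X).symm
    have hi : ∑ t ∈ s.powerset, C (∑ i ∈ insert a t, if Odd i then (i : ℤ) else -i) *
          X ^ (∑ i ∈ insert a t, i) =
        X ^ a * ∑ t ∈ s.powerset, C (∑ i ∈ t, if Odd i then (i : ℤ) else -i) * X ^ (∑ i ∈ t, i) +
          C (if Odd a then (a : ℤ) else -a) * X ^ a * ∑ t ∈ s.powerset, X ^ (∑ i ∈ t, i) := by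
      rw [Finset.mul_sum, Finset.mul_sum, ← Finset.sum_add_distrib]
      refine Finset.sum_congr rfl fun t ht => ?_
      have hat : a ∉ t := fun h => ha (Finset.mem_powerset.1 ht h)
      rw [Finset.sum_insert hat, Finset.sum_insert hat, map_add]
      ring
    rw [Finset.sum_powerset_insert ha, hi, hF, ih, Finset.prod_insert ha, Finset.prod_insert ha]
    split_ifs with h
    · rw [one_mul, Derivation.leibniz, map_add, Derivation.map_one_eq_zero,
        eulerDerivation_X_pow, smul_eq_mul, smul_eq_mul]
      ring
    · rw [one_mul, Derivation.leibniz, map_add, Derivation.map_one_eq_zero,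
        eulerDerivation_X_pow, smul_eq_mul, smul_eq_mul, map_neg]
      ring

theorem DSOME_eq_coeff {F O : ℤ⟦X⟧}
    (hF : ∀ N, X ^ N ∣ F - ∏ i ∈ Finset.range N, (1 + X ^ (i + 1)))
    (hO : ∀ N, X ^ N ∣ O - ∏ i ∈ Finset.range N, (1 + X ^ (2 * i + 1))) (n : ℕ) :
    DSOME n = coeff n (expand 2 two_ne_zero F * eulerDerivation ℤ O -
        O * eulerDerivation ℤ (expand 2 two_ne_zero F)) := by
  have hprod : ∀ N, (∏ i ∈ Finset.Ico 1 (2 * N + 1), if Odd i then 1 + X ^ i else 1 : ℤ⟦X⟧) =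
      ∏ i ∈ Finset.range N, (1 + X ^ (2 * i + 1)) ∧
      (∏ i ∈ Finset.Ico 1 (2 * N + 1), if Odd i then 1 else 1 + X ^ i : ℤ⟦X⟧) =
      expand 2 two_ne_zero (∏ i ∈ Finset.range N, (1 + X ^ (i + 1))) := fun N => by
    induction N with
    | zero => simp
    | succ N ih =>
      have h1 : ¬ Odd (2 * N + 1 + 1) := by simp [parity_simps]
      have h2 : Odd (2 * N + 1) := ⟨N, rfl⟩
      rw [show 2 * (N + 1) + 1 = 2 * N + 1 + 1 + 1 by ring,
        Finset.prod_Ico_succ_top (Nat.le_add_left 1 _),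
        Finset.prod_Ico_succ_top (Nat.le_add_left 1 _),
        Finset.prod_Ico_succ_top (Nat.le_add_left 1 _),
        Finset.prod_Ico_succ_top (Nat.le_add_left 1 _),
        ih.1, ih.2, Finset.prod_range_succ, Finset.prod_range_succ, map_mul, map_add, map_one, map_pow,
        expand_X, if_neg h1, if_neg h1, if_pos h2, if_pos h2, ← pow_mul]
      exact ⟨mul_one _, by ring⟩
  have h1 := congrArg (coeff n) (sum_powerset_C_mul_X_pow (Finset.Ico 1 (2 * (n + 1) + 1)))
  rw [(hprod _).1, (hprod _).2, map_sum] at h1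
  simp only [coeff_C_mul, coeff_X_pow, mul_ite, mul_one, mul_zero, eq_comm (a := n)] at h1
  rw [← Finset.sum_filter, ← DSOME_eq_sum_powerset (by omega)] at h1
  obtain ⟨a, ha⟩ := hO (n + 1)
  obtain ⟨b, hb⟩ := X_pow_dvd_expand (hF (n + 1))
  obtain ⟨a', ha'⟩ := X_pow_dvd_eulerDerivation (hO (n + 1))
  obtain ⟨b', hb'⟩ := X_pow_dvd_eulerDerivation (X_pow_dvd_expand (hF (n + 1)))
  rw [map_sub] at hb ha'
  rw [map_sub, map_sub] at hb'
  rw [h1, ← sub_eq_zero, ← map_sub]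
  set P := ∏ i ∈ Finset.range (n + 1), (1 + X ^ (2 * i + 1) : ℤ⟦X⟧)
  set Q := expand 2 two_ne_zero (∏ i ∈ Finset.range (n + 1), (1 + X ^ (i + 1) : ℤ⟦X⟧))
  refine X_pow_dvd_iff.1 (Dvd.intro (-(b * eulerDerivation ℤ O + Q * a') +
    a * eulerDerivation ℤ (expand 2 two_ne_zero F) + P * b') ?_) n (Nat.lt_add_one n)
  linear_combination eulerDerivation ℤ O * hb + Q * ha' - P * hb' -
    eulerDerivation ℤ (expand 2 two_ne_zero F) * ha

/-- The integer solutions of `x ^ 2 + 24 * k ^ 2 = m` with `x ≡ -1 [ZMOD 6]`. -/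
noncomputable def normSolutions (m : ℕ) : Finset (ℤ × ℤ) :=
  (Finset.Icc (-m : ℤ) m ×ˢ Finset.Icc (-m : ℤ) m).filter
    fun z => z.1 % 6 = 5 ∧ z.1 ^ 2 + 24 * z.2 ^ 2 = m

theorem mem_normSolutions {m : ℕ} {z : ℤ × ℤ} :
    z ∈ normSolutions m ↔ z.1 % 6 = 5 ∧ z.1 ^ 2 + 24 * z.2 ^ 2 = m := by
  simp only [normSolutions, Finset.mem_filter, Finset.mem_product, Finset.mem_Icc,
    and_iff_right_iff_imp]
  rintro ⟨-, h⟩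
  refine ⟨⟨?_, ?_⟩, ?_, ?_⟩ <;> nlinarith [sq_nonneg z.1, sq_nonneg z.2, Int.le_self_sq z.1,
    Int.le_self_sq z.2, Int.le_self_sq (-z.1), Int.le_self_sq (-z.2)]

/-- Multiplication by `1 + 2√-6`, in the coordinates `x + 2k√-6`. -/
def mulNorm25 : ℤ × ℤ ↪ ℤ × ℤ where
  toFun z := (z.1 - 24 * z.2, z.1 + z.2)
  inj' := by
    rintro ⟨a, b⟩ ⟨c, d⟩ h
    simp only [Prod.mk.injEq] at h ⊢
    omega

/-- Multiplication by `1 - 2√-6`, in the coordinates `x + 2k√-6`. -/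
def mulNorm25Conj : ℤ × ℤ ↪ ℤ × ℤ where
  toFun z := (z.1 + 24 * z.2, z.2 - z.1)
  inj' := by
    rintro ⟨a, b⟩ ⟨c, d⟩ h
    simp only [Prod.mk.injEq] at h ⊢
    omega

/-- Multiplication by `25`. -/
def mul25 : ℤ × ℤ ↪ ℤ × ℤ where
  toFun z := (25 * z.1, 25 * z.2)
  inj' := by
    rintro ⟨a, b⟩ ⟨c, d⟩ h
    simp only [Prod.mk.injEq] at h ⊢
    omega

theorem mulNorm25_apply (z : ℤ × ℤ) : mulNorm25 z = (z.1 - 24 * z.2, z.1 + z.2) := rfl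

theorem mulNorm25Conj_apply (z : ℤ × ℤ) : mulNorm25Conj z = (z.1 + 24 * z.2, z.2 - z.1) := rfl

theorem mul25_apply (z : ℤ × ℤ) : mul25 z = (25 * z.1, 25 * z.2) := rfl

theorem dvd_sub_or_dvd_add_of_norm {x k m : ℤ} (h : x ^ 2 + 24 * k ^ 2 = 625 * m) :
    25 ∣ x - k ∨ 25 ∣ x + k := by
  have h5 : Prime (5 : ℤ) := by norm_num
  have h1 : (x - k) * (x + k) = 25 * (25 * m - k ^ 2) := by linarith
  by_cases ha : (5 : ℤ) ∣ x - k <;> by_cases hb : (5 : ℤ) ∣ x + k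
  · obtain ⟨y, rfl⟩ : (5 : ℤ) ∣ x := by omega
    obtain ⟨l, rfl⟩ : (5 : ℤ) ∣ k := by omega
    have h2 : (5 : ℤ) ∣ (y - l) * (y + l) := ⟨5 * m - 5 * l ^ 2, by linarith⟩
    rcases h5.dvd_or_dvd h2 with h3 | h3 <;> omega
  · left
    have hc : IsCoprime (25 : ℤ) (x + k) := by
      have : IsCoprime (5 : ℤ) (x + k) := (h5.coprime_iff_not_dvd).2 hb
      simpa using this.pow_left (m := 2)
    exact hc.dvd_of_dvd_mul_right ⟨_, h1⟩
  · right
    have hc : IsCoprime (25 : ℤ) (x - k) := by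
      have : IsCoprime (5 : ℤ) (x - k) := (h5.coprime_iff_not_dvd).2 ha
      simpa using this.pow_left (m := 2)
    exact hc.dvd_of_dvd_mul_left ⟨_, h1⟩
  · have h2 : (5 : ℤ) ∣ (x - k) * (x + k) := ⟨5 * (25 * m - k ^ 2), by linarith⟩
    rcases h5.dvd_or_dvd h2 with h3 | h3 <;> contradiction

theorem normSolutions_union (m : ℕ) :
    (normSolutions (25 * m)).map mulNorm25 ∪ (normSolutions (25 * m)).map mulNorm25Conj =
      normSolutions (625 * m) := by
  ext ⟨x, k⟩
  simp only [Finset.mem_union, Finset.mem_map, mem_normSolutions, mulNorm25_apply,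
    mulNorm25Conj_apply, Prod.exists, Prod.mk.injEq]
  push_cast
  constructor
  · rintro (⟨a, b, ⟨h, h'⟩, rfl, rfl⟩ | ⟨a, b, ⟨h, h'⟩, rfl, rfl⟩)
    · exact ⟨by omega, by linarith⟩
    · exact ⟨by omega, by linarith⟩
  · rintro ⟨h, h'⟩
    rcases dvd_sub_or_dvd_add_of_norm h' with ⟨c, hc⟩ | ⟨c, hc⟩
    · obtain rfl : x = k + 25 * c := by linarith
      exact Or.inl ⟨k + c, -c, ⟨by omega, by linarith⟩, by ring, by ring⟩
    · obtain rfl : x = -k + 25 * c := by linarith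
      exact Or.inr ⟨-k + c, c, ⟨by omega, by linarith⟩, by ring, by ring⟩

theorem normSolutions_inter (m : ℕ) :
    (normSolutions (25 * m)).map mulNorm25 ∩ (normSolutions (25 * m)).map mulNorm25Conj =
      (normSolutions m).map mul25 := by
  ext ⟨x, k⟩
  simp only [Finset.mem_inter, Finset.mem_map, mem_normSolutions, mulNorm25_apply,
    mulNorm25Conj_apply, mul25_apply, Prod.exists, Prod.mk.injEq]
  push_cast
  constructor
  · rintro ⟨⟨a, b, ⟨h, h'⟩, rfl, rfl⟩, ⟨c, d, -, h1, h2⟩⟩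
    obtain ⟨y, hy⟩ : (25 : ℤ) ∣ a - 24 * b := by omega
    obtain ⟨l, hl⟩ : (25 : ℤ) ∣ a + b := by omega
    obtain rfl : a = y + 24 * l := by linarith
    obtain rfl : b = l - y := by linarith
    exact ⟨y, l, ⟨by omega, by linarith⟩, by ring, by ring⟩
  · rintro ⟨a, b, ⟨h, h'⟩, rfl, rfl⟩
    exact ⟨⟨a + 24 * b, b - a, ⟨by omega, by linarith⟩, by ring, by ring⟩,
      ⟨a - 24 * b, a + b, ⟨by omega, by linarith⟩, by ring, by ring⟩⟩

theorem sum_normSolutions_mul_625 (m : ℕ) (f : ℤ × ℤ → ℤ) :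
    ∑ z ∈ normSolutions (625 * m), f z =
      ∑ z ∈ normSolutions (25 * m), (f (mulNorm25 z) + f (mulNorm25Conj z)) -
        ∑ z ∈ normSolutions m, f (mul25 z) := by
  have h := Finset.sum_union_inter (s₁ := (normSolutions (25 * m)).map mulNorm25)
    (s₂ := (normSolutions (25 * m)).map mulNorm25Conj) (f := f)
  rw [normSolutions_union, normSolutions_inter] at h
  simp only [Finset.sum_map] at h
  rw [Finset.sum_add_distrib]
  linarith

/-- The sign `(-1) ^ ((x + 1) / 6 + k)`. -/
def normSign (z : ℤ × ℤ) : ℤ := Int.negOnePow ((z.1 + 1) / 6 + z.2)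

theorem normSign_mulNorm25 {z : ℤ × ℤ} (h : z.1 % 6 = 5) :
    normSign (mulNorm25 z) = -normSign z := by
  obtain ⟨x, k⟩ := z
  dsimp only at h
  simp only [normSign, mulNorm25_apply]
  rw [← Units.val_neg, ← Int.negOnePow_succ, Units.val_inj, Int.negOnePow_eq_iff, Int.even_iff]
  omega

theorem normSign_mulNorm25Conj {z : ℤ × ℤ} (h : z.1 % 6 = 5) :
    normSign (mulNorm25Conj z) = -normSign z := by
  obtain ⟨x, k⟩ := z
  dsimp only at h
  simp only [normSign, mulNorm25Conj_apply]
  rw [← Units.val_neg, ← Int.negOnePow_succ, Units.val_inj, Int.negOnePow_eq_iff, Int.even_iff]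
  omega

theorem normSign_mul25 {z : ℤ × ℤ} (h : z.1 % 6 = 5) : normSign (mul25 z) = normSign z := by
  obtain ⟨x, k⟩ := z
  dsimp only at h
  simp only [normSign, mul25_apply]
  rw [Units.val_inj, Int.negOnePow_eq_iff, Int.even_iff]
  omega

/-- The coefficients of the theta series `∑ ± q ^ (x ^ 2 + 24 * k ^ 2)`, of weight one. -/
noncomputable def thetaOne (m : ℕ) : ℤ := ∑ z ∈ normSolutions m, normSign z

/-- The coefficients of the theta series `∑ ± (x ^ 2 - 24 * k ^ 2) q ^ (x ^ 2 + 24 * k ^ 2)`,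
of weight three. -/
noncomputable def thetaThree (m : ℕ) : ℤ :=
  ∑ z ∈ normSolutions m, normSign z * (z.1 ^ 2 - 24 * z.2 ^ 2)

theorem thetaOne_mul_625 (m : ℕ) :
    thetaOne (625 * m) = -2 * thetaOne (25 * m) - thetaOne m := by
  simp only [thetaOne]
  rw [sum_normSolutions_mul_625, Finset.mul_sum]
  congr 1 <;> refine Finset.sum_congr rfl fun z hz => ?_ <;>
    have h := (mem_normSolutions.1 hz).1
  · rw [normSign_mulNorm25 h, normSign_mulNorm25Conj h]
    ring
  · exact normSign_mul25 h

theorem thetaThree_mul_625 (m : ℕ) :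
    thetaThree (625 * m) = 46 * thetaThree (25 * m) - 625 * thetaThree m := by
  simp only [thetaThree]
  rw [sum_normSolutions_mul_625, Finset.mul_sum, Finset.mul_sum]
  congr 1 <;> refine Finset.sum_congr rfl fun z hz => ?_ <;>
    have h := (mem_normSolutions.1 hz).1
  · rw [normSign_mulNorm25 h, normSign_mulNorm25Conj h]
    simp only [mulNorm25_apply, mulNorm25Conj_apply]
    ring
  · rw [normSign_mul25 h]
    simp only [mul25_apply]
    ring

theorem thetaOne_emod_two (m : ℕ) :
    (thetaOne m : ZMod 2) = ((normSolutions m).filter (·.2 = 0)).card := by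
  have hs : ∀ z, ((normSign z : ℤ) : ZMod 2) = 1 := fun z => by
    rcases Int.units_eq_one_or (Int.negOnePow ((z.1 + 1) / 6 + z.2)) with h | h <;>
      simp [normSign, h]
  rw [thetaOne, Int.cast_sum, ← Finset.sum_filter_add_sum_filter_not _ (fun z => z.2 = 0)]
  simp only [hs]
  rw [Finset.sum_const, nsmul_one, add_eq_left]
  refine Finset.sum_involution (fun z _ => (z.1, -z.2)) (fun _ _ => by decide) ?_ ?_ ?_
  · intro z hz _ h
    have h1 := congrArg Prod.snd h
    simp only [Finset.mem_filter] at hz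
    dsimp only at h1
    omega
  · intro z hz
    simp only [Finset.mem_filter, mem_normSolutions] at hz ⊢
    simpa using hz
  · simp

theorem thetaOne_mul_25_emod_two (m : ℕ) : thetaOne (25 * m) ≡ thetaOne m [ZMOD 2] := by
  refine (ZMod.intCast_eq_intCast_iff _ _ 2).1 ?_
  rw [thetaOne_emod_two, thetaOne_emod_two]
  congr 1
  refine (Finset.card_bij (fun z _ => (-5 * z.1, z.2)) ?_ ?_ ?_).symm
  · rintro ⟨x, k⟩ hz
    simp only [Finset.mem_filter, mem_normSolutions] at hz ⊢
    obtain ⟨⟨h, h'⟩, rfl⟩ := hz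
    push_cast
    exact ⟨⟨by omega, by linarith⟩, trivial⟩
  · rintro ⟨x, k⟩ _ ⟨y, l⟩ _ h
    simp only [Prod.mk.injEq] at h ⊢
    omega
  · rintro ⟨x, k⟩ hz
    simp only [Finset.mem_filter, mem_normSolutions] at hz
    obtain ⟨⟨h, h'⟩, rfl⟩ := hz
    push_cast at h'
    have h5 : Prime (5 : ℤ) := by norm_num
    obtain ⟨y, rfl⟩ : (5 : ℤ) ∣ x := h5.dvd_of_dvd_pow (n := 2) ⟨5 * m, by linarith⟩
    refine ⟨(-y, 0), ?_, by simp⟩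
    simp only [Finset.mem_filter, mem_normSolutions]
    exact ⟨⟨by omega, by linarith⟩, trivial⟩

/-- The integers `x ≡ -1 [ZMOD 6]` with `x ^ 2 = 24 * a + 1`. -/
noncomputable def pentagonalRoots (a : ℕ) : Finset ℤ :=
  (Finset.Icc (-(24 * a + 1) : ℤ) (24 * a + 1)).filter fun x => x % 6 = 5 ∧ x ^ 2 = 24 * a + 1

theorem mem_pentagonalRoots {a : ℕ} {x : ℤ} :
    x ∈ pentagonalRoots a ↔ x % 6 = 5 ∧ x ^ 2 = 24 * a + 1 := by
  rw [pentagonalRoots, Finset.mem_filter, Finset.mem_Icc, and_iff_right_iff_imp]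
  rintro ⟨-, h⟩
  constructor <;> nlinarith [Int.le_self_sq x, Int.le_self_sq (-x)]

/-- The integers `k` with `k ^ 2 = b`. -/
noncomputable def squareRoots (b : ℕ) : Finset ℤ :=
  (Finset.Icc (-b : ℤ) b).filter fun k => k ^ 2 = b

theorem mem_squareRoots {b : ℕ} {k : ℤ} : k ∈ squareRoots b ↔ k ^ 2 = b := by
  rw [squareRoots, Finset.mem_filter, Finset.mem_Icc, and_iff_right_iff_imp]
  intro h
  constructor <;> nlinarith [Int.le_self_sq k, Int.le_self_sq (-k)]

theorem coeff_pentagonalSeries_eq_sum (a : ℕ) :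
    coeff a (pentagonalSeries ℤ) =
      ∑ x ∈ pentagonalRoots a, (Int.negOnePow ((x + 1) / 6) : ℤ) := by
  by_cases h : a ∈ Set.range pentagonal
  · obtain ⟨j, rfl⟩ := h
    have hj := two_mul_natCast_pentagonal j
    rw [coeff_pentagonalSeries_pentagonal, Finset.sum_eq_single (6 * j - 1)]
    · rw [show (6 * j - 1 + 1) / 6 = j by omega, Int.cast_id]
    · intro x hx hne
      obtain ⟨h6, hx⟩ := mem_pentagonalRoots.1 hx
      have h0 : (x - (6 * j - 1)) * (x + (6 * j - 1)) = 0 := by linarith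
      rcases mul_eq_zero.1 h0 with h | h <;> omega
    · intro hx
      exact absurd (mem_pentagonalRoots.2 ⟨by omega, by linarith⟩) hx
  · rw [coeff_pentagonalSeries_eq_zero ℤ h, Finset.sum_eq_zero]
    intro x hx
    obtain ⟨h6, hx⟩ := mem_pentagonalRoots.1 hx
    refine absurd ⟨(x + 1) / 6, ?_⟩ h
    obtain ⟨j, rfl⟩ : ∃ j, x = 6 * j - 1 := ⟨(x + 1) / 6, by omega⟩
    have hj := two_mul_natCast_pentagonal j
    rw [show (6 * j - 1 + 1) / 6 = j by omega]
    zify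
    linarith

theorem coeff_one_add_two_mul_squareSeries_eq_sum (b : ℕ) :
    coeff b (1 + 2 * squareSeries) =
      ∑ k ∈ squareRoots b, (Int.negOnePow k : ℤ) := by
  rw [two_mul, map_add, map_add, squareSeries, coeff_mk, coeff_one]
  rcases Nat.eq_zero_or_pos b with rfl | hb
  · simp [squareRoots, Finset.filter_singleton]
  rw [if_neg hb.ne', zero_add]
  split_ifs with h
  · obtain ⟨-, r, rfl⟩ := h
    have hr : 0 < r := Nat.pos_of_mul_pos_left hb
    have hs : squareRoots (r * r) = {(r : ℤ), -(r : ℤ)} := by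
      ext k
      rw [mem_squareRoots, Finset.mem_insert, Finset.mem_singleton, Nat.cast_mul, ← sq]
      exact sq_eq_sq_iff_eq_or_eq_neg
    rw [hs, Finset.sum_pair (by omega), Int.negOnePow_neg, pow_mul]
    rcases Nat.even_or_odd r with he | ho
    · rw [he.neg_one_pow, one_pow, Int.negOnePow_even _ (by exact_mod_cast he)]
      rfl
    · rw [ho.neg_one_pow, ho.neg_one_pow, Int.negOnePow_odd _ (by exact_mod_cast ho)]
      rfl
  · rw [Finset.sum_eq_zero, add_zero]
    intro k hk
    refine absurd ⟨hb, k.natAbs, ?_⟩ h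
    zify
    rw [← sq, sq_abs, mem_squareRoots.1 hk]

theorem coeff_mul_eulerDerivation_sub (f g : ℤ⟦X⟧) (n : ℕ) :
    coeff n (g * eulerDerivation ℤ f - f * eulerDerivation ℤ g) =
      ∑ p ∈ Finset.HasAntidiagonal.antidiagonal n, coeff p.1 f * coeff p.2 g * (p.1 - p.2) := by
  rw [mul_comm g, map_sub, coeff_mul, coeff_mul, ← Finset.sum_sub_distrib]
  refine Finset.sum_congr rfl fun p _ => ?_
  rw [coeff_eulerDerivation, coeff_eulerDerivation]
  ring

theorem mul_coeff_eq_thetaThree_sub_thetaOne (n : ℕ) :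
    24 * coeff n ((1 + 2 * squareSeries) * eulerDerivation ℤ (pentagonalSeries ℤ) -
        pentagonalSeries ℤ * eulerDerivation ℤ (1 + 2 * squareSeries)) =
      thetaThree (24 * n + 1) - thetaOne (24 * n + 1) := by
  rw [coeff_mul_eulerDerivation_sub, thetaThree, thetaOne, ← Finset.sum_sub_distrib, Finset.mul_sum]
  have hmaps : ∀ z ∈ normSolutions (24 * n + 1),
      ((z.1 ^ 2 / 24).toNat, z.2.natAbs ^ 2) ∈ Finset.HasAntidiagonal.antidiagonal n := by
    rintro ⟨x, k⟩ hz
    obtain ⟨-, h⟩ := mem_normSolutions.1 hz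
    push_cast at h
    have := sq_nonneg x
    rw [Finset.HasAntidiagonal.mem_antidiagonal]
    zify
    rw [sq_abs]
    omega
  rw [← Finset.sum_fiberwise_of_maps_to hmaps]
  refine Finset.sum_congr rfl fun p hp => ?_
  obtain ⟨a, b⟩ := p
  have hp := Finset.HasAntidiagonal.mem_antidiagonal.1 hp
  have hfib : (normSolutions (24 * n + 1)).filter
      (fun z => ((z.1 ^ 2 / 24).toNat, z.2.natAbs ^ 2) = (a, b)) =
      pentagonalRoots a ×ˢ squareRoots b := by
    ext ⟨x, k⟩
    rw [Finset.mem_filter, Finset.mem_product, mem_normSolutions, mem_pentagonalRoots,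
      mem_squareRoots, Prod.mk.injEq]
    zify
    rw [sq_abs]
    have := sq_nonneg x
    constructor
    · rintro ⟨⟨h, h'⟩, h1, h2⟩
      exact ⟨⟨h, by omega⟩, h2⟩
    · rintro ⟨⟨h, h'⟩, h2⟩
      exact ⟨⟨h, by omega⟩, by omega, h2⟩
  rw [hfib, Finset.sum_product, coeff_pentagonalSeries_eq_sum,
    coeff_one_add_two_mul_squareSeries_eq_sum, Finset.sum_mul_sum, Finset.sum_mul, Finset.mul_sum]
  refine Finset.sum_congr rfl fun x hx => ?_
  rw [Finset.sum_mul, Finset.mul_sum]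
  refine Finset.sum_congr rfl fun k hk => ?_
  rw [(mem_pentagonalRoots.1 hx).2, mem_squareRoots.1 hk, normSign, Int.negOnePow_add,
    Units.val_mul]
  ring

theorem exists_thetaThree_sub_thetaOne_DSOME_modEq (n : ℕ) :
    ∃ c, 24 * c = thetaThree (24 * n + 1) - thetaOne (24 * n + 1) ∧ DSOME n ≡ c [ZMOD 8] := by
  obtain ⟨F, hF⟩ := exists_X_pow_dvd_sub
    (fun N => ∏ i ∈ Finset.range N, (1 + X ^ (i + 1))) fun N =>
      ⟨X * ∏ i ∈ Finset.range N, (1 + X ^ (i + 1)), by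
        rw [Finset.prod_range_succ]
        ring⟩
  obtain ⟨O, hO⟩ := exists_X_pow_dvd_sub
    (fun N => ∏ i ∈ Finset.range N, (1 + X ^ (2 * i + 1))) fun N =>
      ⟨X ^ (N + 1) * ∏ i ∈ Finset.range N, (1 + X ^ (2 * i + 1)), by
        rw [Finset.prod_range_succ]
        ring⟩
  have hF1 : constantCoeff F = 1 := by
    have h := X_pow_dvd_iff.1 (hF 1) 0 one_pos
    rw [map_sub, sub_eq_zero] at h
    simpa using h
  have hG := mul_squareSeries_eq_pentagonalSeries hF
  obtain ⟨D, hD⟩ := exists_derivation_sub_eq_add_eight_mul F O hF1 (eq_mul_expand hF hO)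
    (hG ▸ expand_pentagonalSeries hF)
  rw [hG] at hD
  refine ⟨_, mul_coeff_eq_thetaThree_sub_thetaOne n, ?_⟩
  rw [DSOME_eq_coeff hF hO, hD, map_add, show (8 : ℤ⟦X⟧) = C (8 : ℤ) from (map_ofNat C 8).symm,
    coeff_C_mul]
  exact (Int.modEq_iff_add_fac.2 ⟨_, rfl⟩).symm

theorem DSOME_internal_congruence (n : ℕ) :
    DSOME (15625 * n + 651) ≡
      5 * DSOME (25 * n + 1) + DSOME (625 * n + 26) - 5 * DSOME n [ZMOD 8] := by
  obtain ⟨c0, h0, e0⟩ := exists_thetaThree_sub_thetaOne_DSOME_modEq n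
  obtain ⟨c1, h1, e1⟩ := exists_thetaThree_sub_thetaOne_DSOME_modEq (25 * n + 1)
  obtain ⟨c2, h2, e2⟩ := exists_thetaThree_sub_thetaOne_DSOME_modEq (625 * n + 26)
  obtain ⟨c3, h3, e3⟩ := exists_thetaThree_sub_thetaOne_DSOME_modEq (15625 * n + 651)
  have a1 := thetaOne_mul_625 (24 * n + 1)
  have a2 := thetaOne_mul_625 (25 * (24 * n + 1))
  have b1 := thetaThree_mul_625 (24 * n + 1)
  have b2 := thetaThree_mul_625 (25 * (24 * n + 1))
  have p := thetaOne_mul_25_emod_two (24 * n + 1)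
  rw [show 24 * (25 * n + 1) + 1 = 25 * (24 * n + 1) by ring] at h1
  rw [show 24 * (625 * n + 26) + 1 = 625 * (24 * n + 1) by ring] at h2
  rw [show 24 * (15625 * n + 651) + 1 = 625 * (25 * (24 * n + 1)) by ring] at h3
  rw [show 25 * (25 * (24 * n + 1)) = 625 * (24 * n + 1) by ring] at a2 b2
  simp only [Int.ModEq] at *
  omega
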